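/- Let G = ⟨a,b_1,…,b_r⟩ be a multi-GGS-group with r ≥ 2. Then G is just infinite: G is infinite and every nontrivial normal subgroup of G has finite index in G. -/

import Mathlib

/-!
Automorphisms of the `p`-regular rooted tree, encoded by portraits:
an automorphism is a family of permutations of `Fin p`, one for each vertex
(vertices are finite words over `Fin p`, the root being `[]`).
-/

namespace TreeAut

variable {p : ℕ}

/-- Automorphisms of the `p`-regular rooted tree, given by their portraits. -/
def AutT (p : ℕ) : Type := List (Fin p) → Equiv.Perm (Fin p)

namespace AutT

/-- The action of a tree automorphism on the vertices (finite words over `Fin p`). -/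
def act : AutT p → List (Fin p) → List (Fin p)
  | _, [] => []
  | f, x :: w => f [] x :: act (fun v => f (x :: v)) w

/-- The section of `f` at the level-one vertex `x`; the map
`f ↦ (sections f 0, …, sections f (p-1))` restricted to the first-level
stabilizer is the isomorphism `ψ`. -/
def sections (f : AutT p) : Fin p → AutT p := fun x v => f (x :: v)

instance : One (AutT p) := ⟨fun _ => 1⟩

instance : Mul (AutT p) := ⟨fun f g v => f (act g v) * g v⟩

/-- The action of the inverse automorphism on vertices. -/
def invAct : AutT p → List (Fin p) → List (Fin p)
  | _, [] => []
  | f, x :: w => (f [])⁻¹ x :: invAct (fun v => f (((f [])⁻¹ x) :: v)) w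

instance : Inv (AutT p) := ⟨fun f v => (f (invAct f v))⁻¹⟩

lemma one_apply (v : List (Fin p)) : (1 : AutT p) v = 1 := rfl

lemma mul_apply (f g : AutT p) (v : List (Fin p)) : (f * g) v = f (act g v) * g v := rfl

lemma inv_apply (f : AutT p) (v : List (Fin p)) : f⁻¹ v = (f (invAct f v))⁻¹ := rfl

lemma act_nil (f : AutT p) : act f [] = [] := rfl

lemma act_cons (f : AutT p) (x : Fin p) (w : List (Fin p)) :
    act f (x :: w) = f [] x :: act (sections f x) w := rfl

lemma sections_mul (f g : AutT p) (x : Fin p) :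
    sections (f * g) x = sections f (g [] x) * sections g x :=
  funext fun _ => rfl

lemma act_one : ∀ v : List (Fin p), act (1 : AutT p) v = v
  | [] => rfl
  | x :: w => congrArg (x :: ·) (act_one w)

lemma act_mul (f g : AutT p) : ∀ v : List (Fin p), act (f * g) v = act f (act g v)
  | [] => rfl
  | x :: w => by
      rw [act_cons (f * g), sections_mul, act_mul, act_cons g, act_cons f]
      rfl

lemma invAct_act (f : AutT p) : ∀ v : List (Fin p), invAct f (act f v) = v
  | [] => rfl
  | x :: w => by
      rw [act_cons]
      show (f [])⁻¹ (f [] x) ::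
          invAct (fun v => f (((f [])⁻¹ (f [] x)) :: v)) (act (sections f x) w) = x :: w
      have key : ∀ y : Fin p, x = y →
          y :: invAct (fun v => f (y :: v)) (act (sections f x) w) = x :: w := by
        intro y hy
        subst hy
        exact congrArg (x :: ·) (invAct_act (sections f x) w)
      exact key _ (Equiv.symm_apply_apply (f []) x).symm

instance : Group (AutT p) where
  mul_assoc f g h := by
    funext v
    show (f * g) (act h v) * h v = f (act (g * h) v) * (g * h) v
    rw [mul_apply, mul_apply, act_mul, mul_assoc]
  one_mul f := by
    funext v
    show (1 : AutT p) (act f v) * f v = f v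
    rw [one_apply, one_mul]
  mul_one f := by
    funext v
    show f (act (1 : AutT p) v) * (1 : AutT p) v = f v
    rw [act_one, one_apply, mul_one]
  inv_mul_cancel f := by
    funext v
    show f⁻¹ (act f v) * f v = (1 : AutT p) v
    rw [inv_apply, invAct_act, one_apply, inv_mul_cancel]

lemma act_length (f : AutT p) : ∀ v : List (Fin p), (act f v).length = v.length
  | [] => rfl
  | _ :: w => congrArg Nat.succ (act_length _ w)

lemma act_act_inv (f : AutT p) (v : List (Fin p)) : act f (act f⁻¹ v) = v := by
  rw [← act_mul, mul_inv_cancel, act_one]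

/-- The pointwise stabilizer `st(n)` of the `n`-th level of the tree. -/
def levelStab (p n : ℕ) : Subgroup (AutT p) where
  carrier := {f | ∀ v : List (Fin p), v.length = n → act f v = v}
  one_mem' := fun v _ => act_one v
  mul_mem' := by
    intro f g hf hg v hv
    rw [act_mul, hg v hv, hf v hv]
  inv_mem' := by
    intro f hf v hv
    have h1 : act f (act f⁻¹ v) = v := act_act_inv f v
    have h2 : act f (act f⁻¹ v) = act f⁻¹ v := hf _ (by rw [act_length, hv])
    exact h2.symm.trans h1

instance levelStab_normal (p n : ℕ) : (levelStab p n).Normal := by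
  constructor
  intro f hf g v hv
  show act (g * f * g⁻¹) v = v
  rw [act_mul, act_mul, hf _ (by rw [act_length, hv]), act_act_inv]

/-- The tuple of sections at the level-two vertices.  Restricted to the
second-level stabilizer this is the map `ψ₂`. -/
def sections2 (f : AutT p) : Fin p → Fin p → AutT p := fun x y v => f (x :: y :: v)

/-- The rooted automorphism defined by a permutation `σ` of `Fin p`. -/
def rooted (σ : Equiv.Perm (Fin p)) : AutT p := fun v => if v = [] then σ else 1

/-- The rooted automorphism `a`, acting at the root by the cycle `(1 2 … p)`. -/
def rootedA (p : ℕ) : AutT p := rooted (finRotate p)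

/-- Auxiliary portrait for the directed automorphism `b_e`. -/
def directedAux (e : Fin (p - 1) → ZMod p) : List (Fin p) → Equiv.Perm (Fin p)
  | [] => 1
  | x :: w =>
      if h : (x : ℕ) < p - 1 then
        (if w = [] then finRotate p ^ ((e ⟨x, h⟩).val) else 1)
      else directedAux e w

/-- The directed automorphism `b_e` defined by the vector `e ∈ 𝔽_p^{p-1}`,
i.e. the unique automorphism with `ψ(b_e) = (a^{e_1}, …, a^{e_{p-1}}, b_e)`. -/
def directed (e : Fin (p - 1) → ZMod p) : AutT p := directedAux e

/-- The multi-GGS-group determined by the vectors `e 1, …, e r`. -/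
def multiGGS (p : ℕ) {r : ℕ} (e : Fin r → Fin (p - 1) → ZMod p) : Subgroup (AutT p) :=
  Subgroup.closure ({rootedA p} ∪ Set.range fun i => directed (e i))

/-- The GGS-group `𝒢` defined by the (nonzero) constant vector `(c, …, c)`. -/
def constGGS (p : ℕ) (c : ZMod p) : Subgroup (AutT p) :=
  Subgroup.closure {rootedA p, directed (fun _ => c)}

/-- `G` is the GGS-group `𝒢` defined by a constant vector. -/
def IsConstGGS {p : ℕ} (G : Subgroup (AutT p)) : Prop :=
  ∃ c : ZMod p, c ≠ 0 ∧ G = constGGS p c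

/-- The stabilizer `st_G(n) = G ∩ st(n)`, viewed as a subgroup of `G`. -/
def stabIn {p : ℕ} (G : Subgroup (AutT p)) (n : ℕ) : Subgroup G :=
  (levelStab p n).comap G.subtype

instance {p : ℕ} (G : Subgroup (AutT p)) (n : ℕ) : (stabIn G n).Normal :=
  Subgroup.Normal.comap (levelStab_normal p n) G.subtype

/-- The congruence subgroup property: every finite-index subgroup of `G`
contains a level stabilizer `st_G(n)`. -/
def HasCSP {p : ℕ} (G : Subgroup (AutT p)) : Prop :=
  ∀ H : Subgroup G, H.FiniteIndex → ∃ n : ℕ, stabIn G n ≤ H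

/-- `G` is just infinite: it is infinite and all its nontrivial normal
subgroups have finite index. -/
def JustInfinite {p : ℕ} (G : Subgroup (AutT p)) : Prop :=
  Infinite G ∧ ∀ N : Subgroup G, N.Normal → N ≠ ⊥ → N.FiniteIndex

end AutT

end TreeAut

open TreeAut AutT Subgroup

open scoped commutatorElement

/-! ### General group theory -/

section GroupTheory

variable {Γ : Type*} [Group Γ]

/-- A commutative group generated by a finite set of torsion elements is finite. -/
lemma finite_of_closure_eq_top_of_isOfFinOrder {A : Type*} [CommGroup A] {S : Set A}
    (hS : S.Finite) (hord : ∀ s ∈ S, IsOfFinOrder s) (hgen : closure S = ⊤) : Finite A := by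
  have : Group.FG A := ⟨⟨hS.toFinset, by simpa using hgen⟩⟩
  refine CommGroup.finite_of_fg_isMulTorsion A fun x => ?_
  have h : closure S ≤ CommGroup.torsion A := (closure_le _).2 hord
  rw [hgen] at h
  exact h (mem_top x)

/-- A group of nilpotency class at most two that is generated by a finite set of torsion
elements is finite. -/
lemma finite_of_commutator_le_center {S : Set Γ} (hS : S.Finite)
    (hord : ∀ s ∈ S, IsOfFinOrder s) (hgen : closure S = ⊤)
    (hcen : _root_.commutator Γ ≤ center Γ) : Finite Γ := by
  have : Finite (Abelianization Γ) := by
    refine finite_of_closure_eq_top_of_isOfFinOrder (hS.image Abelianization.of) ?_ ?_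
    · rintro _ ⟨s, hs, rfl⟩
      exact Abelianization.of.isOfFinOrder (hord s hs)
    · rw [← MonoidHom.map_closure, hgen, ← MonoidHom.range_eq_map, MonoidHom.range_eq_top]
      exact QuotientGroup.mk'_surjective _
  have : Finite (Γ ⧸ _root_.commutator Γ) := ‹Finite (Abelianization Γ)›
  have : Finite (commutatorSet Γ) := by
    refine Set.Finite.to_subtype ((Set.finite_range fun q : (Γ ⧸ _root_.commutator Γ) ×
      (Γ ⧸ _root_.commutator Γ) => ⁅q.1.out, q.2.out⁆).subset ?_)
    rintro _ ⟨x, y, rfl⟩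
    refine ⟨(x, y), ?_⟩
    obtain ⟨⟨c, hc⟩, hx⟩ := QuotientGroup.mk_out_eq_mul (_root_.commutator Γ) x
    obtain ⟨⟨d, hd⟩, hy⟩ := QuotientGroup.mk_out_eq_mul (_root_.commutator Γ) y
    have hc' := mem_center_iff.1 (hcen hc)
    have hd' := mem_center_iff.1 (hcen hd)
    simp only at hx hy ⊢
    rw [hx, hy, commutatorElement_mul_left_eq_conj_mul,
      commutatorElement_eq_one_iff_mul_comm.2 (hc' (y * d)).symm,
      commutatorElement_mul_right_eq_mul_conj,
      commutatorElement_eq_one_iff_mul_comm.2 (hd' x)]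
    simp
  exact Finite.of_subgroup_quotient (_root_.commutator Γ)

/-- In a group generated by a finite set of torsion elements, the third term of the lower
central series has finite index. -/
lemma relIndex_commutator_commutator_ne_zero {S : Set Γ} (hS : S.Finite)
    (hord : ∀ s ∈ S, IsOfFinOrder s) :
    (⁅closure S, ⁅closure S, closure S⁆⁆).relIndex (closure S) ≠ 0 := by
  set G := closure S with hG
  let L : Subgroup G := ⁅(⊤ : Subgroup G), ⁅(⊤ : Subgroup G), ⊤⁆⁆
  have hL : L.map G.subtype = ⁅G, ⁅G, G⁆⁆ := by
    simp only [L, map_commutator, ← MonoidHom.range_eq_map, range_subtype]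
  have hfin : Finite (G ⧸ L) := by
    have hsurj := QuotientGroup.mk'_surjective L
    have htop : (⊤ : Subgroup G).map (QuotientGroup.mk' L) = ⊤ := by
      rw [← MonoidHom.range_eq_map, MonoidHom.range_eq_top]; exact hsurj
    refine finite_of_commutator_le_center
      (S := Set.image (QuotientGroup.mk' L) (Set.preimage Subtype.val S))
      ((hS.preimage Subtype.val_injective.injOn).image _)
      ?_ ?_ ?_
    · rintro _ ⟨s, hs, rfl⟩
      exact (QuotientGroup.mk' L).isOfFinOrder
        (Submonoid.isOfFinOrder_coe.1 (hord _ hs))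
    · rw [← MonoidHom.map_closure, closure_closure_coe_preimage, htop]
    · rw [← commutator_top_left_eq_bot_iff_le_center, _root_.commutator_def, ← htop,
        ← map_commutator, ← map_commutator, Subgroup.map_eq_bot_iff, QuotientGroup.ker_mk']
  rw [← hL, relIndex, subgroupOf, comap_map_eq_self_of_injective G.subtype_injective]
  exact index_ne_zero_of_finite

/-- If `R` is normalized by the group generated by `S` and contains all commutators of
elements of `S`, then it contains the derived subgroup. -/
lemma commutator_closure_le {S : Set Γ} {R : Subgroup Γ}
    (hR : ∀ g ∈ closure S, ∀ x ∈ R, g * x * g⁻¹ ∈ R) (hS : ∀ s ∈ S, ∀ t ∈ S, ⁅s, t⁆ ∈ R) :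
    ⁅closure S, closure S⁆ ≤ R := by
  have key : ∀ T : Set Γ, (∀ s ∈ S, ∀ t ∈ T, ⁅s, t⁆ ∈ R) →
      ∀ g ∈ closure S, ∀ t ∈ T, ⁅g, t⁆ ∈ R := by
    intro T hST g hg t ht
    induction hg using closure_induction with
    | mem s hs => exact hST s hs t ht
    | one => simp [R.one_mem]
    | mul x y hx hy ihx ihy =>
      rw [commutatorElement_mul_left_eq_conj_mul]
      exact R.mul_mem (hR x hx _ ihy) ihx
    | inv x hx ih =>
      rw [commutatorElement_inv_left, ← commutatorElement_inv]
      simpa using hR x⁻¹ (inv_mem hx) _ (R.inv_mem ih)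
  refine commutator_le.2 (key _ fun s hs g hg => ?_)
  rw [← commutatorElement_inv]
  exact R.inv_mem (key S hS g hg s hs)

/-- A subgroup normalized by `G` absorbs commutators with elements of `G`. -/
lemma commutatorElement_mem_of_normalized {G N : Subgroup Γ}
    (hN : ∀ g ∈ G, ∀ x ∈ N, g * x * g⁻¹ ∈ N) {g x : Γ} (hx : x ∈ N) (hg : g ∈ G) :
    ⁅x, g⁆ ∈ N := by
  have h := N.mul_mem hx (hN g hg _ (N.inv_mem hx))
  rwa [← mul_assoc, ← mul_assoc, ← commutatorElement_def] at h

/-- The left factor normalizes a commutator subgroup. -/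
lemma conj_mem_commutator {H K : Subgroup Γ} {g x : Γ} (hg : g ∈ H)
    (hx : x ∈ ⁅H, K⁆) : g * x * g⁻¹ ∈ ⁅H, K⁆ :=
  (mem_normalizer_iff.1 (normalizer_commutator_ge_left H K hg) x).1 hx

end GroupTheory

namespace TreeAut.AutT

/-! ### Sections and vertex embeddings -/

section Tree

variable {p : ℕ}

lemma ext_sections {f g : AutT p} (h0 : f [] = g []) (h : ∀ x, sections f x = sections g x) :
    f = g := by
  funext v
  cases v with
  | nil => exact h0
  | cons x w => exact congrFun (h x) w

/-- The action of an automorphism on the first level. -/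
def rootHom (p : ℕ) : AutT p →* Equiv.Perm (Fin p) where
  toFun f := f []
  map_one' := rfl
  map_mul' _ _ := rfl

@[simp] lemma rootHom_apply (f : AutT p) : rootHom p f = f [] := rfl

lemma mul_nil (f g : AutT p) : (f * g) [] = f [] * g [] := rfl

lemma inv_nil (f : AutT p) : f⁻¹ [] = (f [])⁻¹ := rfl

@[simp] lemma sections_one (x : Fin p) : sections (1 : AutT p) x = 1 := rfl

lemma sections_inv (f : AutT p) (x : Fin p) :
    sections f⁻¹ x = (sections f ((f [])⁻¹ x))⁻¹ := by
  rw [eq_inv_iff_mul_eq_one]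
  have h := sections_mul f⁻¹ f ((f [])⁻¹ x)
  rwa [inv_mul_cancel, sections_one, eq_comm,
    show f [] ((f [])⁻¹ x) = x from (f []).apply_symm_apply x] at h

lemma sections_mul_of_nil (f : AutT p) {g : AutT p} (hg : g [] = 1) (x : Fin p) :
    sections (f * g) x = sections f x * sections g x := by
  rw [sections_mul, hg, Equiv.Perm.one_apply]

lemma sections_inv_of_nil {f : AutT p} (hf : f [] = 1) (x : Fin p) :
    sections f⁻¹ x = (sections f x)⁻¹ := by
  rw [sections_inv, hf, inv_one, Equiv.Perm.one_apply]

lemma sections_commutator_of_nil {f g : AutT p} (hf : f [] = 1) (hg : g [] = 1) (x : Fin p) :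
    sections ⁅f, g⁆ x = ⁅sections f x, sections g x⁆ := by
  simp only [commutatorElement_def]
  rw [sections_mul_of_nil _ (by simp [inv_nil, hg]), sections_mul_of_nil _ (by simp [inv_nil, hf]),
    sections_mul_of_nil _ hg, sections_inv_of_nil hf, sections_inv_of_nil hg]

/-- The section at a first-level vertex, as a homomorphism on the first-level stabilizer. -/
def sectionHom (x : Fin p) : (rootHom p).ker →* AutT p where
  toFun f := sections f.1 x
  map_one' := rfl
  map_mul' _ g := sections_mul_of_nil _ g.2 x

/-- The automorphism fixing the first level with prescribed sections; inverse to `ψ`. -/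
def ofSections (p : ℕ) : (Fin p → AutT p) →* AutT p where
  toFun F v := match v with
    | [] => 1
    | x :: w => F x w
  map_one' := by
    funext v
    cases v <;> rfl
  map_mul' F G := by
    funext v
    cases v <;> rfl

lemma ofSections_sections {f : AutT p} (hf : f [] = 1) : ofSections p (sections f) = f :=
  ext_sections hf.symm fun _ => rfl

/-- The embedding of `Aut(T)` onto the rigid stabilizer of the first-level vertex `x`. -/
def single (x : Fin p) : AutT p →* AutT p :=
  (ofSections p).comp (MonoidHom.mulSingle (fun _ => AutT p) x)

lemma single_nil (x : Fin p) (g : AutT p) : single x g [] = 1 := rfl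

lemma sections_single (x : Fin p) (g : AutT p) :
    sections (single x g) = Pi.mulSingle x g := rfl

lemma eq_single {f g : AutT p} {x : Fin p} (h0 : f [] = 1) (hx : sections f x = g)
    (h : ∀ y, y ≠ x → sections f y = 1) : f = single x g := by
  refine ext_sections h0 fun y => ?_
  rw [sections_single]
  rcases eq_or_ne y x with rfl | hy
  · rw [hx, Pi.mulSingle_eq_same]
  · rw [h y hy, Pi.mulSingle_eq_of_ne hy]

lemma mul_single (g k : AutT p) (x : Fin p) :
    g * single x k = single (g [] x) (sections g x * k * (sections g x)⁻¹) * g := by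
  refine ext_sections rfl fun y => ?_
  rw [sections_mul, sections_mul, single_nil, sections_single, sections_single,
    Equiv.Perm.one_apply]
  rcases eq_or_ne y x with rfl | hy
  · simp
  · rw [Pi.mulSingle_eq_of_ne hy, Pi.mulSingle_eq_of_ne ((g []).injective.ne hy)]
    simp

lemma conj_single (g k : AutT p) (x : Fin p) :
    g * single x k * g⁻¹ = single (g [] x) (sections g x * k * (sections g x)⁻¹) := by
  rw [mul_single, mul_inv_cancel_right]

lemma commutator_single {f : AutT p} (hf : f [] = 1) (k : AutT p) (x : Fin p) :
    ⁅f, single x k⁆ = single x ⁅sections f x, k⁆ := by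
  rw [commutatorElement_def, conj_single, hf, Equiv.Perm.one_apply, commutatorElement_def,
    map_mul (single x) _ k⁻¹, map_inv]

lemma commute_single {x y : Fin p} (h : x ≠ y) (f g : AutT p) :
    Commute (single x f) (single y g) :=
  (Pi.mulSingle_commute (f := fun _ => AutT p) h f g).map (ofSections p)

/-- The embedding of `Aut(T)` onto the rigid stabilizer of the vertex `u`. -/
def embed : List (Fin p) → AutT p →* AutT p
  | [] => MonoidHom.id _
  | x :: u => (single x).comp (embed u)

/-- The section of an automorphism at an arbitrary vertex. -/
def sectionAt (f : AutT p) : List (Fin p) → AutT p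
  | [] => f
  | x :: u => sectionAt (sections f x) u

lemma embed_cons (x : Fin p) (u : List (Fin p)) (k : AutT p) :
    embed (x :: u) k = single x (embed u k) := rfl

lemma embed_append (u v : List (Fin p)) (k : AutT p) :
    embed (u ++ v) k = embed u (embed v k) := by
  induction u with
  | nil => rfl
  | cons x u ih => rw [List.cons_append, embed_cons, embed_cons, ih]

lemma conj_embed (g k : AutT p) (u : List (Fin p)) :
    g * embed u k * g⁻¹ = embed (act g u) (sectionAt g u * k * (sectionAt g u)⁻¹) := by
  induction u generalizing g with
  | nil => rfl
  | cons x u ih => rw [embed_cons, conj_single, ih, act_cons, embed_cons]; rfl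

lemma commute_embed {u v : List (Fin p)} (hlen : u.length = v.length) (h : u ≠ v)
    (f g : AutT p) : Commute (embed u f) (embed v g) := by
  induction u generalizing v with
  | nil => exact absurd (List.length_eq_zero_iff.1 hlen.symm).symm h
  | cons x u ih =>
    cases v with
    | nil => simp at hlen
    | cons y v =>
      rw [embed_cons, embed_cons]
      rcases eq_or_ne x y with rfl | hxy
      · exact (ih (by simpa using hlen) (by simpa using h)).map (single x)
      · exact commute_single hxy _ _

lemma eq_one_of_act {f : AutT p} (h : ∀ v, act f v = v) : f = 1 := by
  funext v
  induction v generalizing f with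
  | nil =>
    ext x
    have := h [x]
    simp only [act_cons, List.cons.injEq] at this
    rw [this.1]; rfl
  | cons x w ih =>
    refine ih (f := sections f x) fun v => ?_
    have := h (x :: v)
    simp only [act_cons, List.cons.injEq] at this
    exact this.2

/-- If `N` is normalized by `G` and some element of `N` moves the vertex `u`, then `N` contains
the commutators of elements of `G` in the rigid stabilizer of `u`. -/
lemma embed_commutator_mem {G N : Subgroup (AutT p)}
    (hN : ∀ g ∈ G, ∀ x ∈ N, g * x * g⁻¹ ∈ N) {g h k : AutT p} {u : List (Fin p)}
    (hg : g ∈ N) (hu : act g u ≠ u) (hh : embed u h ∈ G) (hk : embed u k ∈ G) :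
    embed u ⁅h, k⁆ ∈ N := by
  have hy : Commute (g * (embed u h)⁻¹ * g⁻¹) (embed u k) := by
    rw [← map_inv, conj_embed]
    exact commute_embed (act_length g u) hu _ _
  have hmem : embed u h * (g * (embed u h)⁻¹ * g⁻¹) ∈ N := by
    simpa only [mul_assoc] using N.mul_mem (hN _ hh _ hg) (N.inv_mem hg)
  have hcomm := commutatorElement_mem_of_normalized hN hmem hk
  rwa [commutatorElement_mul_left_eq_conj_mul, hy.commutator_eq, mul_one, mul_inv_cancel, one_mul,
    ← map_commutatorElement] at hcomm

end Tree
/-! ### The generators -/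

section Generators

variable {p : ℕ} [Fact p.Prime]

lemma val_finRotate_pow (n : ℕ) (x : Fin p) : ((finRotate p ^ n) x : ℕ) = (x + n) % p := by
  induction n with
  | zero => simp [Nat.mod_eq_of_lt x.isLt]
  | succ n ih =>
    have h1 : ((1 : Fin p) : ℕ) = 1 % p := rfl
    rw [pow_succ', Equiv.Perm.mul_apply, finRotate_apply, Fin.val_add, ih, h1, ← Nat.add_mod,
      add_assoc]

lemma finRotate_pow_val_apply (c x : Fin p) : (finRotate p ^ c.val) x = x + c :=
  Fin.ext (by rw [val_finRotate_pow, Fin.val_add])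

lemma finRotate_pow_self : finRotate p ^ p = 1 := by
  ext x
  rw [val_finRotate_pow, Nat.add_mod_right, Nat.mod_eq_of_lt x.isLt, Equiv.Perm.one_apply]

lemma finRotate_pow_val_add (s t : ZMod p) :
    finRotate p ^ (s + t).val = finRotate p ^ s.val * finRotate p ^ t.val := by
  rw [← pow_add, ZMod.val_add, ← pow_mod_orderOf _ (s.val + t.val),
    ← pow_mod_orderOf _ ((s.val + t.val) % p),
    Nat.mod_mod_of_dvd _ (orderOf_dvd_of_pow_eq_one finRotate_pow_self)]

/-- Rooted automorphisms, as a homomorphism. -/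
def rootedHom (p : ℕ) : Equiv.Perm (Fin p) →* AutT p where
  toFun := rooted
  map_one' := by
    funext v
    cases v <;> rfl
  map_mul' σ τ := ext_sections rfl fun x => (one_mul (1 : AutT p)).symm

lemma sections_rooted {p : ℕ} (σ : Equiv.Perm (Fin p)) (x : Fin p) :
    sections (rooted σ) x = 1 := rfl

lemma rootedA_pow {p : ℕ} (n : ℕ) : rootedA p ^ n = rooted (finRotate p ^ n) :=
  (map_pow (rootedHom p) (finRotate p) n).symm

lemma rootedA_pow_nil {p : ℕ} (n : ℕ) : (rootedA p ^ n) [] = finRotate p ^ n := by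
  rw [rootedA_pow]; rfl

lemma rootedA_pow_self : rootedA p ^ p = 1 := by
  rw [rootedA_pow, finRotate_pow_self]; exact map_one (rootedHom p)

/-- Conjugation by a power of `a` rotates the sections. -/
lemma sections_conj_rootedA (c : Fin p) {g : AutT p} (hg : g [] = 1) (x : Fin p) :
    sections (rootedA p ^ c.val * g * (rootedA p ^ c.val)⁻¹) x = sections g (x - c) := by
  have hinv : ((rootedA p ^ c.val) [])⁻¹ x = x - c := by
    rw [rootedA_pow_nil, Equiv.Perm.inv_eq_iff_eq, finRotate_pow_val_apply, sub_add_cancel]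
  rw [sections_mul, inv_nil, hinv, sections_mul_of_nil _ hg, sections_inv, hinv, rootedA_pow,
    sections_rooted, one_mul, inv_one, mul_one]

lemma conj_nil {p : ℕ} (f : AutT p) {g : AutT p} (hg : g [] = 1) : (f * g * f⁻¹) [] = 1 := by
  rw [mul_nil, mul_nil, hg, inv_nil, mul_one, mul_inv_cancel]

/-- The last first-level vertex, at which `b_e` has section `b_e`. -/
def last (p : ℕ) [Fact p.Prime] : Fin p := ⟨p - 1, Nat.sub_one_lt (Fact.out : p.Prime).ne_zero⟩

/-- The vector `v`, extended by zero to the last vertex. -/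
def coord (v : Fin (p - 1) → ZMod p) (x : Fin p) : ZMod p :=
  if h : (x : ℕ) < p - 1 then v ⟨x, h⟩ else 0

lemma coord_add (v w : Fin (p - 1) → ZMod p) (x : Fin p) :
    coord (v + w) x = coord v x + coord w x := by
  unfold coord; split_ifs <;> simp

lemma coord_smul (t : ZMod p) (v : Fin (p - 1) → ZMod p) (x : Fin p) :
    coord (t • v) x = t * coord v x := by
  unfold coord; split_ifs <;> simp

lemma coord_last (v : Fin (p - 1) → ZMod p) : coord v (last p) = 0 := by
  simp [coord, last]

lemma exists_coord_ne_zero {v : Fin (p - 1) → ZMod p} (hv : v ≠ 0) : ∃ x, coord v x ≠ 0 := by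
  obtain ⟨i, hi⟩ := Function.ne_iff.1 hv
  exact ⟨⟨i, by omega⟩, by simpa [coord] using hi⟩

lemma val_lt_of_ne_last {x : Fin p} (h : x ≠ last p) : (x : ℕ) < p - 1 := by
  have h1 : (x : ℕ) ≠ p - 1 := fun hx => h (Fin.ext hx)
  omega

lemma directed_nil {p : ℕ} (v : Fin (p - 1) → ZMod p) : directed v [] = 1 := rfl

lemma sections_directed_last (v : Fin (p - 1) → ZMod p) :
    sections (directed v) (last p) = directed v := by
  funext w
  show directedAux v (last p :: w) = directedAux v w
  simp [directedAux, last]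

lemma sections_directed_of_ne (v : Fin (p - 1) → ZMod p) {x : Fin p} (h : x ≠ last p) :
    sections (directed v) x = rootedA p ^ (coord v x).val := by
  have hx := val_lt_of_ne_last h
  rw [rootedA_pow]
  funext w
  show directedAux v (x :: w) = _
  simp [directedAux, rooted, coord, hx]

lemma rootedA_pow_val_add (s t : ZMod p) :
    rootedA p ^ (s + t).val = rootedA p ^ s.val * rootedA p ^ t.val := by
  rw [rootedA_pow, finRotate_pow_val_add, rootedA_pow, rootedA_pow]
  exact map_mul (rootedHom p) _ _

lemma directed_add (v w : Fin (p - 1) → ZMod p) :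
    directed (v + w) = directed v * directed w := by
  funext l
  induction l with
  | nil => rfl
  | cons x l ih =>
    show sections (directed (v + w)) x l = sections (directed v * directed w) x l
    rw [sections_mul_of_nil _ (directed_nil w)]
    rcases eq_or_ne x (last p) with rfl | hx
    · simpa only [sections_directed_last] using ih
    · simp only [sections_directed_of_ne _ hx, coord_add, rootedA_pow_val_add]

/-- Directed automorphisms, as a homomorphism. -/
def directedHom (p : ℕ) [Fact p.Prime] : Multiplicative (Fin (p - 1) → ZMod p) →* AutT p :=
  MonoidHom.mk' (fun v => directed v.toAdd) fun _ _ => directed_add _ _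

lemma directed_zero : directed (0 : Fin (p - 1) → ZMod p) = 1 := map_one (directedHom p)

lemma commute_directed (v w : Fin (p - 1) → ZMod p) : Commute (directed v) (directed w) := by
  rw [Commute, SemiconjBy, ← directed_add, ← directed_add, add_comm]

lemma directed_smul (t : ZMod p) (v : Fin (p - 1) → ZMod p) :
    directed (t • v) = directed v ^ t.val := by
  have h : t • v = t.val • v := by
    rw [← Nat.cast_smul_eq_nsmul (ZMod p), ZMod.natCast_zmod_val]
  rw [h]
  exact map_pow (directedHom p) (Multiplicative.ofAdd v) _

lemma isOfFinOrder_directed (v : Fin (p - 1) → ZMod p) : IsOfFinOrder (directed v) :=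
  (directedHom p).isOfFinOrder (isOfFinOrder_of_finite (Multiplicative.ofAdd v))

lemma isOfFinOrder_rootedA {p : ℕ} : IsOfFinOrder (rootedA p) :=
  (rootedHom p).isOfFinOrder (isOfFinOrder_of_finite (finRotate p))

/-- A subgroup containing a nontrivial power of `a` contains `a`. -/
lemma rootedA_mem_of_pow_mem {H : Subgroup (AutT p)} {t : ZMod p} (ht : t ≠ 0)
    (h : rootedA p ^ t.val ∈ H) : rootedA p ∈ H := by
  have hpow := H.pow_mem h t⁻¹.val
  rw [← pow_mul] at hpow
  have hmod : t.val * t⁻¹.val ≡ 1 [MOD p] := by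
    rw [← ZMod.natCast_eq_natCast_iff]
    simp [ht]
  have hpow_eq := pow_eq_pow_iff_modEq.2
    (hmod.of_dvd (orderOf_dvd_of_pow_eq_one (rootedA_pow_self (p := p))))
  rwa [hpow_eq, pow_one] at hpow

end Generators
/-! ### The group attached to a space of defining vectors -/

section Branching

variable {p : ℕ} [Fact p.Prime]

/-- The group generated by `a` and all `b_v` with `v` in the subspace `E`. -/
def spanGGS (E : Submodule (ZMod p) (Fin (p - 1) → ZMod p)) : Subgroup (AutT p) :=
  closure ({rootedA p} ∪ directed '' (E : Set (Fin (p - 1) → ZMod p)))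

lemma multiGGS_eq_spanGGS {r : ℕ} (e : Fin r → Fin (p - 1) → ZMod p) :
    multiGGS p e = spanGGS (Submodule.span (ZMod p) (Set.range e)) := by
  apply le_antisymm
  · refine closure_mono (Set.union_subset_union_right _ ?_)
    rintro _ ⟨i, rfl⟩
    exact ⟨e i, Submodule.subset_span ⟨i, rfl⟩, rfl⟩
  · refine (closure_le _).2 (Set.union_subset ?_ ?_)
    · rintro _ rfl
      exact subset_closure (Or.inl rfl)
    · rintro _ ⟨v, hv, rfl⟩
      induction hv using Submodule.span_induction with
      | mem v hv =>
        obtain ⟨i, rfl⟩ := hv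
        exact subset_closure (Or.inr ⟨i, rfl⟩)
      | zero => rw [directed_zero]; exact one_mem _
      | add v w _ _ hv hw => rw [directed_add]; exact mul_mem hv hw
      | smul t v _ hv => rw [directed_smul]; exact pow_mem hv _

variable {E : Submodule (ZMod p) (Fin (p - 1) → ZMod p)}

lemma rootedA_mem : rootedA p ∈ spanGGS E := subset_closure (Or.inl rfl)

lemma rootedA_pow_mem (n : ℕ) : rootedA p ^ n ∈ spanGGS E := pow_mem rootedA_mem n

lemma directed_mem {v : Fin (p - 1) → ZMod p} (hv : v ∈ E) : directed v ∈ spanGGS E :=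
  subset_closure (Or.inr ⟨v, hv, rfl⟩)

lemma spanGGS_le {H : Subgroup (AutT p)} (ha : rootedA p ∈ H) (hb : ∀ v ∈ E, directed v ∈ H) :
    spanGGS E ≤ H := by
  refine (closure_le _).2 (Set.union_subset ?_ ?_)
  · rintro _ rfl
    exact ha
  · rintro _ ⟨v, hv, rfl⟩
    exact hb v hv

/-- Sections of elements of the group lie in the group. -/
lemma sections_mem {g : AutT p} (hg : g ∈ spanGGS E) (x : Fin p) : sections g x ∈ spanGGS E := by
  induction hg using closure_induction generalizing x with
  | mem g hg =>
    rcases hg with rfl | ⟨v, hv, rfl⟩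
    · exact one_mem _
    · rcases eq_or_ne x (last p) with rfl | hx
      · rw [sections_directed_last]
        exact directed_mem hv
      · rw [sections_directed_of_ne _ hx]
        exact rootedA_pow_mem _
  | one => exact one_mem _
  | mul f g _ _ hf hg => rw [sections_mul]; exact mul_mem (hf _) (hg _)
  | inv f _ hf => rw [sections_inv]; exact inv_mem (hf _)

lemma sectionAt_mem {g : AutT p} (hg : g ∈ spanGGS E) (u : List (Fin p)) :
    sectionAt g u ∈ spanGGS E := by
  induction u generalizing g with
  | nil => exact hg
  | cons x u ih => exact ih (sections_mem hg x)

lemma nil_mem_zpowers {g : AutT p} (hg : g ∈ spanGGS E) :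
    g [] ∈ zpowers (finRotate p) := by
  have h : spanGGS E ≤ (zpowers (finRotate p)).comap (rootHom p) :=
    spanGGS_le (mem_zpowers _) fun v _ => (one_mem _ : directed v [] ∈ zpowers (finRotate p))
  exact h hg

/-- The derived subgroup fixes the first level. -/
lemma nil_of_mem_commutator {g : AutT p} (hg : g ∈ ⁅spanGGS E, spanGGS E⁆) : g [] = 1 := by
  have h : ⁅spanGGS E, spanGGS E⁆ ≤ (rootHom p).ker := by
    refine commutator_le.2 fun f hf g hg => ?_
    rw [MonoidHom.mem_ker, map_commutatorElement, commutatorElement_eq_one_iff_mul_comm]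
    obtain ⟨m, hm⟩ := nil_mem_zpowers hf
    obtain ⟨n, hn⟩ := nil_mem_zpowers hg
    rw [rootHom_apply, rootHom_apply, ← hm, ← hn]
    exact zpow_mul_comm _ _ _
  exact h hg

/-- The sections at `x` of the elements of `H` fixing the first level. -/
def sectionImage (H : Subgroup (AutT p)) (x : Fin p) : Subgroup (AutT p) :=
  (H.subgroupOf (rootHom p).ker).map (sectionHom x)

lemma mem_sectionImage {p : ℕ} {H : Subgroup (AutT p)} {x : Fin p} {g : AutT p} :
    g ∈ sectionImage H x ↔ ∃ h ∈ H, h [] = 1 ∧ sections h x = g := by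
  constructor
  · rintro ⟨⟨h, h0⟩, hh, rfl⟩
    exact ⟨h, hh, h0, rfl⟩
  · rintro ⟨h, hh, h0, rfl⟩
    exact ⟨⟨h, h0⟩, hh, rfl⟩

lemma sectionImage_le {H : Subgroup (AutT p)}
    (hH : ∀ g ∈ spanGGS E, ∀ h ∈ H, g * h * g⁻¹ ∈ H) (x y : Fin p) :
    sectionImage H x ≤ sectionImage H y := by
  intro g hg
  obtain ⟨h, hh, h0, rfl⟩ := mem_sectionImage.1 hg
  refine mem_sectionImage.2 ⟨_, hH _ (rootedA_pow_mem (y - x).val) h hh, conj_nil _ h0, ?_⟩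
  rw [sections_conj_rootedA _ h0, sub_sub_cancel]

lemma comap_single_le {H : Subgroup (AutT p)}
    (hH : ∀ g ∈ spanGGS E, ∀ h ∈ H, g * h * g⁻¹ ∈ H) (x y : Fin p) :
    H.comap (single x) ≤ H.comap (single y) := by
  intro k hk
  have h := hH _ (rootedA_pow_mem (y - x).val) _ hk
  rwa [conj_single, rootedA_pow_nil, finRotate_pow_val_apply, add_sub_cancel, rootedA_pow,
    sections_rooted, one_mul, inv_one, mul_one] at h

/-- The first-level stabilizer of the group projects onto the group at each vertex. -/
lemma le_sectionImage (hE : ∀ x : Fin p, ∃ u ∈ E, u ≠ 0 ∧ coord u x = 0)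
    (x : Fin p) : spanGGS E ≤ sectionImage (spanGGS E) x := by
  have hconj : ∀ g ∈ spanGGS E, ∀ h ∈ spanGGS E, g * h * g⁻¹ ∈ spanGGS E :=
    fun g hg h hh => mul_mem (mul_mem hg hh) (inv_mem hg)
  refine spanGGS_le ?_ fun v hv => ?_
  · obtain ⟨u, hu, hu0, -⟩ := hE x
    obtain ⟨y, hy⟩ := exists_coord_ne_zero hu0
    have hlast : y ≠ last p := fun h => hy (h ▸ coord_last u)
    refine rootedA_mem_of_pow_mem hy (sectionImage_le hconj y x ?_)
    exact mem_sectionImage.2 ⟨_, directed_mem hu, rfl, sections_directed_of_ne u hlast⟩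
  · refine sectionImage_le hconj (last p) x ?_
    exact mem_sectionImage.2 ⟨_, directed_mem hv, rfl, sections_directed_last v⟩

/-- The derived subgroup projects onto the group at each vertex. -/
lemma le_sectionImage_commutator (hE : ∀ x : Fin p, ∃ u ∈ E, u ≠ 0 ∧ coord u x = 0)
    (x : Fin p) :
    spanGGS E ≤ sectionImage ⁅spanGGS E, spanGGS E⁆ x := by
  have hmove := sectionImage_le (E := E) (H := ⁅spanGGS E, spanGGS E⁆)
    fun g hg h hh => conj_mem_commutator hg hh
  have hsec : ∀ c : Fin p, ∀ v ∈ E, ∀ y, sections (directed v) y *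
      (sections (directed v) (y - c))⁻¹ ∈ sectionImage ⁅spanGGS E, spanGGS E⁆ y := by
    intro c v hv y
    have hmem := commutator_mem_commutator (directed_mem hv) (rootedA_pow_mem (E := E) c.val)
    have hinv : (directed v)⁻¹ [] = 1 := by rw [inv_nil, directed_nil, inv_one]
    refine mem_sectionImage.2 ⟨_, hmem, nil_of_mem_commutator hmem, ?_⟩
    rw [commutatorElement_def, mul_assoc, mul_assoc, ← mul_assoc (rootedA p ^ c.val),
      sections_mul_of_nil _ (conj_nil _ hinv), sections_conj_rootedA _ hinv,
      sections_inv_of_nil (directed_nil v)]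
  obtain ⟨u, hu, hu0, hcoord⟩ := hE 0
  obtain ⟨z, hz⟩ := exists_coord_ne_zero hu0
  have hz_last : z ≠ last p := fun h => hz (h ▸ coord_last u)
  have hz0 : z ≠ 0 := fun h => hz (h ▸ hcoord)
  have h0_last : (0 : Fin p) ≠ last p := by
    intro h
    have h0 : (0 : ℕ) = p - 1 := congrArg Fin.val h
    have := (Fact.out : p.Prime).two_le
    omega
  have ha : ∀ y, rootedA p ∈ sectionImage ⁅spanGGS E, spanGGS E⁆ y := by
    intro y
    have h := hsec z u hu z
    rw [sub_self, sections_directed_of_ne u hz_last, sections_directed_of_ne u h0_last, hcoord,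
      ZMod.val_zero, pow_zero, inv_one, mul_one] at h
    exact hmove z y (rootedA_mem_of_pow_mem hz h)
  refine spanGGS_le (ha x) fun v hv => hmove (last p) x ?_
  have h := hsec z v hv (last p)
  rw [sections_directed_last, sections_directed_of_ne v (by simpa using hz0)] at h
  exact (mul_mem_cancel_right (inv_mem (pow_mem (ha _) _))).1 h

/-- Decomposition of `E` into the pieces on which a property closed under addition is known. -/
lemma forall_mem_of_coord (hE : ∀ x : Fin p, ∃ u ∈ E, u ≠ 0 ∧ coord u x = 0)
    (P : (Fin (p - 1) → ZMod p) → Prop)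
    (hadd : ∀ v ∈ E, ∀ w ∈ E, P v → P w → P (v + w))
    (hbase : ∀ k : Fin p, ∀ v ∈ E, coord v (last p - k) ≠ 0 → ∀ w ∈ E,
      coord w (last p + k) = 0 → P w) : ∀ w ∈ E, P w := by
  intro w hw
  by_cases hsymm : ∀ k : Fin p, (∃ v ∈ E, coord v (last p + k) ≠ 0) →
      ∃ v ∈ E, coord v (last p - k) ≠ 0
  · obtain ⟨u₀, hu₀, hne₀, -⟩ := hE 0
    obtain ⟨y, hy⟩ := exists_coord_ne_zero hne₀
    obtain ⟨u, hu, hne, huy⟩ := hE y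
    obtain ⟨z, hz⟩ := exists_coord_ne_zero hne
    obtain ⟨v, hv, hvy⟩ := hsymm (y - last p) ⟨u₀, hu₀, by rwa [add_sub_cancel]⟩
    obtain ⟨v', hv', hvz⟩ := hsymm (z - last p) ⟨u, hu, by rwa [add_sub_cancel]⟩
    set t := coord w z / coord u z with ht
    have h1 : P (w + (-t) • u) := by
      refine hbase _ v' hv' hvz _ (E.add_mem hw (E.smul_mem _ hu)) ?_
      rw [add_sub_cancel, coord_add, coord_smul, ht]
      field_simp
      ring
    have h2 : P (t • u) := by
      refine hbase _ v hv hvy _ (E.smul_mem _ hu) ?_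
      rw [add_sub_cancel, coord_smul, huy, mul_zero]
    have h3 := hadd _ (E.add_mem hw (E.smul_mem _ hu)) _ (E.smul_mem _ hu) h1 h2
    rwa [add_assoc, ← add_smul, neg_add_cancel, zero_smul, add_zero] at h3
  · push Not at hsymm
    obtain ⟨k, ⟨v, hv, hvk⟩, hk⟩ := hsymm
    refine hbase (-k) v hv ?_ w hw ?_
    · rwa [sub_neg_eq_add]
    · rw [← sub_eq_add_neg]
      exact hk w hw

/-- The derived subgroup contains its own copies at the first-level vertices. -/
lemma commutator_le_comap_single (hE : ∀ x : Fin p, ∃ u ∈ E, u ≠ 0 ∧ coord u x = 0)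
    (x : Fin p) :
    ⁅spanGGS E, spanGGS E⁆ ≤ (⁅spanGGS E, spanGGS E⁆).comap (single x) := by
  have hconj : ∀ g ∈ spanGGS E, ∀ h ∈ ⁅spanGGS E, spanGGS E⁆,
      g * h * g⁻¹ ∈ ⁅spanGGS E, spanGGS E⁆ := fun g hg h hh => conj_mem_commutator hg hh
  refine le_trans ?_ (comap_single_le hconj (last p) x)
  have hnorm : ∀ g ∈ spanGGS E, ∀ k ∈ (⁅spanGGS E, spanGGS E⁆).comap (single (last p)),
      g * k * g⁻¹ ∈ (⁅spanGGS E, spanGGS E⁆).comap (single (last p)) := by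
    intro g hg k hk
    obtain ⟨h, hh, h0, rfl⟩ := mem_sectionImage.1 (le_sectionImage hE (last p) hg)
    have := hconj h hh _ hk
    rwa [conj_single, h0] at this
  have hab : ∀ w ∈ E, ⁅rootedA p, directed w⁆ ∈
      (⁅spanGGS E, spanGGS E⁆).comap (single (last p)) := by
    refine forall_mem_of_coord hE _ ?_ ?_
    · intro v hv w hw hPv hPw
      rw [directed_add, commutatorElement_mul_right_eq_mul_conj, mul_assoc, mul_assoc,
        ← mul_assoc (directed v)]
      exact mul_mem hPv (hnorm _ (directed_mem hv) _ hPw)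
    · intro k v hv hvk w hw hwk
      set f := rootedA p ^ k.val * directed ((coord v (last p - k))⁻¹ • v) *
        (rootedA p ^ k.val)⁻¹ with hf
      have hfG : f ∈ spanGGS E := mul_mem (mul_mem (rootedA_pow_mem _)
        (directed_mem (E.smul_mem _ hv))) (inv_mem (rootedA_pow_mem _))
      have hf0 : f [] = 1 := conj_nil _ (directed_nil _)
      have hfs : ∀ y, sections f y = sections (directed ((coord v (last p - k))⁻¹ • v)) (y - k) :=
        sections_conj_rootedA k (directed_nil _)
      have hk0 : last p - k ≠ last p := fun h => hvk (by rw [h, coord_last])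
      have key : ⁅f, directed w⁆ = single (last p) ⁅rootedA p, directed w⁆ := by
        refine eq_single ?_ ?_ fun y hy => ?_
        · rw [commutatorElement_def, mul_nil, conj_nil _ (directed_nil w), one_mul, inv_nil,
            directed_nil, inv_one]
        · rw [sections_commutator_of_nil hf0 (directed_nil w), sections_directed_last, hfs,
            sections_directed_of_ne _ hk0, coord_smul, inv_mul_cancel₀ hvk, ZMod.val_one, pow_one]
        · rw [sections_commutator_of_nil hf0 (directed_nil w), sections_directed_of_ne w hy, hfs]
          by_cases hyk : y - k = last p
          · rw [← hyk, sub_add_cancel] at hwk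
            rw [hwk, ZMod.val_zero, pow_zero, commutatorElement_one_right]
          · rw [sections_directed_of_ne _ hyk]
            exact ((Commute.refl (rootedA p)).pow_pow _ _).commutator_eq
      rw [mem_comap, ← key]
      exact commutator_mem_commutator hfG (directed_mem hw)
  refine commutator_closure_le hnorm ?_
  rintro _ (rfl | ⟨v, hv, rfl⟩) _ (rfl | ⟨w, hw, rfl⟩)
  · rw [commutatorElement_self]
    exact one_mem _
  · exact hab w hw
  · rw [← commutatorElement_inv]
    exact inv_mem (hab v hv)
  · rw [(commute_directed v w).commutator_eq]
    exact one_mem _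

end Branching
section JustInfinite

variable {p : ℕ} [Fact p.Prime] {E : Submodule (ZMod p) (Fin (p - 1) → ZMod p)}

lemma rootedA_ne_one : rootedA p ≠ 1 := by
  intro h
  have h0 : ((finRotate p ^ 1) (0 : Fin p) : ℕ) = 0 := by
    rw [← rootedA_pow_nil, pow_one, h]; rfl
  rw [val_finRotate_pow, Fin.val_zero, zero_add, Nat.mod_eq_of_lt (Fact.out : p.Prime).one_lt] at h0
  exact one_ne_zero h0

/-- The third term of the lower central series has finite index. -/
lemma relIndex_gamma_three_ne_zero :
    (⁅spanGGS E, ⁅spanGGS E, spanGGS E⁆⁆).relIndex (spanGGS E) ≠ 0 := by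
  refine relIndex_commutator_commutator_ne_zero
    ((Set.finite_singleton _).union ((Set.toFinite _).image _)) ?_
  rintro _ (rfl | ⟨v, -, rfl⟩)
  · exact isOfFinOrder_rootedA
  · exact isOfFinOrder_directed v

/-- A subgroup containing the copies of a finite-index subgroup at all vertices of some level
has finite index. -/
lemma relIndex_ne_zero_of_embed_mem {L : Subgroup (AutT p)} (hL : L.relIndex (spanGGS E) ≠ 0)
    (n : ℕ) (N : Subgroup (AutT p))
    (hN : ∀ v : List (Fin p), v.length = n → L ≤ N.comap (embed v)) :
    N.relIndex (spanGGS E) ≠ 0 := by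
  induction n generalizing N with
  | zero => exact fun h => hL (relIndex_eq_zero_of_le_left (hN [] rfl) h)
  | succ n ih =>
    set K := (rootHom p).ker with hK
    have hKfin : K.relIndex (spanGGS E) ≠ 0 := by
      rw [hK, relIndex_ker]
      exact Nat.card_pos.ne'
    have hx : ∀ x : Fin p, ((N.comap (single x)).comap (sectionHom x)).relIndex
        ((spanGGS E).subgroupOf K) ≠ 0 := by
      intro x
      rw [relIndex_comap]
      have hle : ((spanGGS E).subgroupOf K).map (sectionHom x) ≤ spanGGS E := by
        rintro _ ⟨g, hg, rfl⟩
        exact sections_mem hg x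
      refine fun h => ih (N.comap (single x)) (fun v hv => ?_) (relIndex_eq_zero_of_le_right hle h)
      exact hN (x :: v) (by rw [List.length_cons, hv])
    have hinf := relIndex_iInf_ne_zero hx
    have hle : ⨅ x : Fin p, (N.comap (single x)).comap (sectionHom x) ≤ N.subgroupOf K := by
      intro g hg
      rw [mem_iInf] at hg
      have hmem : sections g.1 ∈ N.comap (ofSections p) := pi_mem_of_mulSingle_mem _ hg
      rwa [mem_comap, ofSections_sections g.2] at hmem
    have hNK : (N.subgroupOf K).relIndex ((spanGGS E).subgroupOf K) ≠ 0 :=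
      fun h => hinf (relIndex_eq_zero_of_le_left hle h)
    rw [subgroupOf, relIndex_comap, subgroupOf_map_subtype] at hNK
    have hKG : (spanGGS E ⊓ K).relIndex (spanGGS E) ≠ 0 := by
      rwa [inf_comm, inf_relIndex_right]
    exact relIndex_ne_zero_trans hNK hKG

/-- The second derived subgroup contains the copies of the third term of the lower central series
at the first-level vertices. -/
lemma gamma_three_le_comap_single (hE : ∀ x : Fin p, ∃ u ∈ E, u ≠ 0 ∧ coord u x = 0)
    (x : Fin p) :
    ⁅spanGGS E, ⁅spanGGS E, spanGGS E⁆⁆ ≤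
      (⁅⁅spanGGS E, spanGGS E⁆, ⁅spanGGS E, spanGGS E⁆⁆).comap (single x) := by
  refine commutator_le.2 fun g hg k hk => ?_
  obtain ⟨h, hh, h0, rfl⟩ := mem_sectionImage.1 (le_sectionImage_commutator hE x hg)
  rw [mem_comap, ← commutator_single h0]
  exact commutator_mem_commutator hh (commutator_le_comap_single hE x hk)

lemma embed_mem_commutator (hE : ∀ x : Fin p, ∃ u ∈ E, u ≠ 0 ∧ coord u x = 0)
    {k : AutT p} (hk : k ∈ ⁅spanGGS E, spanGGS E⁆) (u : List (Fin p)) :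
    embed u k ∈ ⁅spanGGS E, spanGGS E⁆ := by
  induction u with
  | nil => exact hk
  | cons x u ih => exact commutator_le_comap_single hE x ih

/-- The group acts transitively on each level of the tree. -/
lemma exists_act_eq (hE : ∀ x : Fin p, ∃ u ∈ E, u ≠ 0 ∧ coord u x = 0)
    {u v : List (Fin p)} (h : u.length = v.length) :
    ∃ g ∈ spanGGS E, act g u = v := by
  induction u generalizing v with
  | nil => exact ⟨1, one_mem _, (List.length_eq_zero_iff.1 h.symm).symm⟩
  | cons x u ih =>
    cases v with
    | nil => simp at h
    | cons y v =>
      obtain ⟨g, hg, rfl⟩ := ih (v := v) (by simpa using h)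
      obtain ⟨f, hf, hf0, rfl⟩ := mem_sectionImage.1 (le_sectionImage hE x hg)
      refine ⟨rootedA p ^ (y - x).val * f, mul_mem (rootedA_pow_mem _) hf, ?_⟩
      rw [act_cons, mul_nil, hf0, mul_one, rootedA_pow_nil, finRotate_pow_val_apply,
        add_sub_cancel, sections_mul_of_nil _ hf0, rootedA_pow, sections_rooted, one_mul]

/-- The group is infinite: it is the image of a section map that is not injective. -/
lemma infinite_spanGGS (hE : ∀ x : Fin p, ∃ u ∈ E, u ≠ 0 ∧ coord u x = 0)
    : Infinite (spanGGS E) := by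
  by_contra hfin
  rw [not_infinite_iff_finite] at hfin
  let F : spanGGS E → spanGGS E := fun g => ⟨sections g.1 0, sections_mem g.2 0⟩
  have hsurj : Function.Surjective F := by
    rintro ⟨g, hg⟩
    obtain ⟨h, hh, -, rfl⟩ := mem_sectionImage.1 (le_sectionImage hE 0 hg)
    exact ⟨⟨h, hh⟩, rfl⟩
  have heq : (⟨rootedA p, rootedA_mem⟩ : spanGGS E) = 1 :=
    Finite.injective_iff_surjective.2 hsurj rfl
  exact rootedA_ne_one (congrArg Subtype.val heq)

/-- Nontrivial subgroups normalized by the group have finite index. -/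
lemma relIndex_ne_zero_of_normalized (hE : ∀ x : Fin p, ∃ u ∈ E, u ≠ 0 ∧ coord u x = 0)
    {N : Subgroup (AutT p)} (hNe : N ≠ ⊥)
    (hN : ∀ g ∈ spanGGS E, ∀ x ∈ N, g * x * g⁻¹ ∈ N) : N.relIndex (spanGGS E) ≠ 0 := by
  have := (nontrivial_iff_ne_bot N).2 hNe
  obtain ⟨g, hg, hg1⟩ := exists_ne_one_of_nontrivial N
  obtain ⟨u, hu⟩ : ∃ u, act g u ≠ u := by
    by_contra! h
    exact hg1 (eq_one_of_act h)
  have hder : ⁅⁅spanGGS E, spanGGS E⁆, ⁅spanGGS E, spanGGS E⁆⁆ ≤ N.comap (embed u) :=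
    commutator_le.2 fun h hh k hk => embed_commutator_mem hN hg hu
      (commutator_le_self _ (embed_mem_commutator hE hh u))
      (commutator_le_self _ (embed_mem_commutator hE hk u))
  refine relIndex_ne_zero_of_embed_mem relIndex_gamma_three_ne_zero (u ++ [last p]).length N ?_
  intro v hv k hk
  obtain ⟨f, hf, rfl⟩ := exists_act_eq hE hv.symm
  set s := sectionAt f (u ++ [last p]) with hs
  have hsG : s⁻¹ ∈ spanGGS E := inv_mem (sectionAt_mem hf _)
  have hmem : embed (u ++ [last p]) (s⁻¹ * k * s⁻¹⁻¹) ∈ N := by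
    rw [embed_append]
    exact hder (gamma_three_le_comap_single hE (last p) (conj_mem_commutator hsG hk))
  have hconj := hN f hf _ hmem
  rw [conj_embed, ← hs] at hconj
  simpa [mul_assoc] using hconj

end JustInfinite

/-- Two linearly independent vectors have nontrivial combinations vanishing at any coordinate. -/
lemma exists_mem_span_coord_eq_zero {p r : ℕ} [Fact p.Prime] (hr : 2 ≤ r)
    {e : Fin r → Fin (p - 1) → ZMod p} (he : LinearIndependent (ZMod p) e) (x : Fin p) :
    ∃ u ∈ Submodule.span (ZMod p) (Set.range e), u ≠ 0 ∧ coord u x = 0 := by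
  set i : Fin r := ⟨0, by omega⟩ with hi
  set j : Fin r := ⟨1, by omega⟩ with hj
  have hij : i ≠ j := by simp [hi, hj]
  have hmem : ∀ k, e k ∈ Submodule.span (ZMod p) (Set.range e) :=
    fun k => Submodule.subset_span ⟨k, rfl⟩
  by_cases h : coord (e i) x = 0
  · exact ⟨e i, hmem i, he.ne_zero i, h⟩
  · refine ⟨coord (e i) x • e j + (-coord (e j) x) • e i,
      add_mem (Submodule.smul_mem _ _ (hmem j)) (Submodule.smul_mem _ _ (hmem i)), ?_, ?_⟩
    · intro h0
      exact h ((LinearIndepOn.pair_iff e hij.symm).1 (he.linearIndepOn _) _ _ h0).1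
    · rw [coord_add, coord_smul, coord_smul]
      ring

end TreeAut.AutT

/-- A multi-GGS-group with `r ≥ 2` directed generators is just infinite. -/
theorem justInfinite_of_two_le
    (p r : ℕ) (hp : p.Prime) (hpodd : Odd p) (hr : 2 ≤ r)
    (e : Fin r → Fin (p - 1) → ZMod p) (he : LinearIndependent (ZMod p) e) :
    JustInfinite (multiGGS p e) := by
  have : Fact p.Prime := ⟨hp⟩
  have hE := exists_mem_span_coord_eq_zero hr he
  rw [multiGGS_eq_spanGGS]
  refine ⟨infinite_spanGGS hE, fun N hN hNe => ⟨?_⟩⟩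
  have hrel := relIndex_ne_zero_of_normalized hE
    (N := N.map (Subgroup.subtype _))
    (fun h => hNe ((map_eq_bot_iff_of_injective N (subtype_injective _)).1 h)) ?_
  · rwa [relIndex, subgroupOf, comap_map_eq_self_of_injective (subtype_injective _)] at hrel
  · rintro g hg _ ⟨x, hx, rfl⟩
    exact ⟨_, hN.conj_mem x hx ⟨g, hg⟩, rfl⟩
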